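/- The total number of places lying over both P and R satisfies |∐_{i=1}^n 𝒫_i| = gcd(e(P/S), e(R/S)). -/

import Mathlib

open scoped TensorProduct

noncomputable section

/-- `K` is the function field of a curve over `k`: a finitely generated field extension of
`k` of transcendence degree `1` (finite over `k(x)` for some transcendental `x`), whose
field of constants is `k` itself. -/
def IsFunctionFieldOver (k K : Type*) [Field k] [Field K] [Algebra k K] : Prop :=
  (∃ x : K, Transcendental k x ∧
    FiniteDimensional ↥(IntermediateField.adjoin k {x}) K) ∧
  (∀ x : K, IsAlgebraic k x → x ∈ (algebraMap k K).range)

/-- A place of a function field `K/k`: a normalized (i.e. surjective onto `ℤₘ₀`) discrete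
valuation which is trivial on the constant field `k`. -/
def IsPlace {k K : Type*} [Field k] [Field K] [Algebra k K]
    (w : Valuation K (WithZero (Multiplicative ℤ))) : Prop :=
  Function.Surjective w ∧ ∀ c : k, c ≠ 0 → w (algebraMap k K c) = 1

/-- The place `w` of `F` lies over the place `v` of `K` (along the embedding `f : K → F`)
with ramification index `e`. -/
def LiesOverE {K F : Type*} [Field K] [Field F]
    (w : Valuation F (WithZero (Multiplicative ℤ))) (f : K →+* F)
    (v : Valuation K (WithZero (Multiplicative ℤ))) (e : ℕ) : Prop :=
  0 < e ∧ ∀ x : K, w (f x) = (v x) ^ e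

/-- The place `w` of `F` lies over the place `v` of `K` (along the embedding `f : K → F`). -/
def LiesOver {K F : Type*} [Field K] [Field F]
    (w : Valuation F (WithZero (Multiplicative ℤ))) (f : K →+* F)
    (v : Valuation K (WithZero (Multiplicative ℤ))) : Prop :=
  ∃ e : ℕ, LiesOverE w f v e

section

open scoped WithZero
open IsDedekindDomain

theorem exists_eq_pow_of_lt_one_iff_mem {B E : Type*} [CommRing B] [IsDedekindDomain B] [Field E]
    [Algebra B E] [IsFractionRing B E] (p : HeightOneSpectrum B) (w : Valuation E ℤᵐ⁰)
    (h1 : ∀ b : B, w (algebraMap B E b) ≤ 1)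
    (hp : ∀ b : B, w (algebraMap B E b) < 1 ↔ b ∈ p.asIdeal) :
    ∃ r : ℕ, 0 < r ∧ ∀ x, w x = p.valuation E x ^ r := by
  have unit : ∀ b : B, b ∉ p.asIdeal → w (algebraMap B E b) = 1 := fun b hb ↦
    le_antisymm (h1 b) (not_lt.1 fun h ↦ hb ((hp b).1 h))
  have key : ∀ x : E, p.valuation E x = 1 → w x = 1 := by
    intro x hx
    obtain ⟨n, d, hnd⟩ := p.exists_primeCompl_mul_eq_of_integer x hx.le
    have hn : n ∉ p.asIdeal := by
      rw [← p.valuation_eq_one_iff_notMem (K := E), ← hnd, map_mul, hx, one_mul,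
        p.valuation_eq_one_iff_notMem]
      exact d.2
    have := congrArg w hnd
    rwa [map_mul, unit _ d.2, unit _ hn, mul_one] at this
  obtain ⟨π, hπ⟩ := p.intValuation_exists_uniformizer
  have hπ' : p.valuation E (algebraMap B E π) = WithZero.exp (-1 : ℤ) := by
    rw [p.valuation_of_algebraMap, hπ]
  have hπ0 : algebraMap B E π ≠ 0 := fun h ↦ by
    rw [h, map_zero] at hπ'; exact WithZero.exp_ne_zero hπ'.symm
  have hwπ : w (algebraMap B E π) < 1 := by
    rw [hp, ← p.valuation_lt_one_iff_mem (K := E), hπ', ← WithZero.exp_zero, WithZero.exp_lt_exp]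
    norm_num
  have hw0 : w (algebraMap B E π) ≠ 0 := by simpa using hπ0
  obtain ⟨m, hm⟩ : ∃ m : ℤ, w (algebraMap B E π) = WithZero.exp m :=
    ⟨_, (WithZero.exp_log hw0).symm⟩
  rw [hm, ← WithZero.exp_zero, WithZero.exp_lt_exp] at hwπ
  refine ⟨(-m).toNat, by omega, fun x ↦ ?_⟩
  rcases eq_or_ne x 0 with rfl | hx
  · rw [map_zero, map_zero, zero_pow]; omega
  obtain ⟨a, ha⟩ : ∃ a : ℤ, p.valuation E x = WithZero.exp a :=
    ⟨_, (WithZero.exp_log (by simpa using hx)).symm⟩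
  have h := key (x * algebraMap B E π ^ a) (by
    rw [map_mul, map_zpow₀, ha, hπ', ← WithZero.exp_zsmul, ← WithZero.exp_add]; simp)
  rw [map_mul, map_zpow₀, hm, ← WithZero.exp_zsmul] at h
  rw [ha, ← WithZero.exp_nsmul, eq_inv_of_mul_eq_one_left h, ← WithZero.exp_neg]
  congr 1
  simp only [smul_eq_mul, nsmul_eq_mul]
  rw [Int.toNat_of_nonneg (by omega)]; ring

set_option linter.deprecated false in
theorem inertiaDeg_eq_one_of_isAlgClosed {A B : Type*} [CommRing A] [IsLocalRing A]
    [IsAlgClosed (IsLocalRing.ResidueField A)] [CommRing B] [Algebra A B] [Algebra.IsIntegral A B]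
    (P : Ideal B) [P.IsPrime] [P.LiesOver (IsLocalRing.maximalIdeal A)] :
    (IsLocalRing.maximalIdeal A).inertiaDeg' P = 1 := by
  rw [Ideal.inertiaDeg'_algebraMap]
  have hint : Algebra.IsIntegral (A ⧸ IsLocalRing.maximalIdeal A) (B ⧸ P) := inferInstance
  have hb : Function.Bijective (algebraMap (A ⧸ IsLocalRing.maximalIdeal A) (B ⧸ P)) :=
    IsAlgClosed.ringHom_bijective_of_isIntegral (k := IsLocalRing.ResidueField A) (K := B ⧸ P)
      (algebraMap (A ⧸ IsLocalRing.maximalIdeal A) (B ⧸ P)) (fun x ↦ hint.isIntegral x)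
  rw [← (LinearEquiv.ofBijective (Algebra.linearMap (A ⧸ IsLocalRing.maximalIdeal A) (B ⧸ P))
    hb).finrank_eq]
  exact Module.finrank_self _

theorem eq_one_of_pow_surjective {E : Type*} [Field E] {w w' : Valuation E ℤᵐ⁰} {r : ℕ}
    (hr : 0 < r) (hw : Function.Surjective w) (h : ∀ x, w x = w' x ^ r) : r = 1 := by
  obtain ⟨x, hx⟩ := hw (WithZero.exp 1)
  have h0 : w' x ≠ 0 := by
    intro h0; rw [h, h0, zero_pow hr.ne'] at hx; exact WithZero.exp_ne_zero hx.symm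
  rw [h, ← WithZero.exp_log h0, ← WithZero.exp_nsmul, WithZero.exp_inj, nsmul_eq_mul] at hx
  exact_mod_cast Int.eq_one_of_mul_eq_one_right (by positivity) hx

theorem exists_ideal_of_valuation_le_one {B E : Type*} [CommRing B] [Field E] [Algebra B E]
    (w : Valuation E ℤᵐ⁰) (h1 : ∀ b : B, w (algebraMap B E b) ≤ 1) :
    ∃ P : Ideal B, P.IsPrime ∧ ∀ b, b ∈ P ↔ w (algebraMap B E b) < 1 := by
  refine ⟨{ carrier := {b | w (algebraMap B E b) < 1}
            add_mem' := fun {a b} ha hb ↦ ?_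
            zero_mem' := by simp
            smul_mem' := fun c b hb ↦ ?_ }, ⟨?_, fun {a b} hab ↦ ?_⟩, fun b ↦ Iff.rfl⟩
  · simpa using w.map_add_lt ha hb
  · simpa using mul_lt_one_of_nonneg_of_lt_one_right (h1 c) zero_le hb
  · rw [Ideal.ne_top_iff_one]
    simp [← SetLike.mem_coe]
  · by_contra! h
    have ha := le_antisymm (h1 a) (not_lt.1 h.1)
    have hb := le_antisymm (h1 b) (not_lt.1 h.2)
    have hab : w (algebraMap B E (a * b)) < 1 := hab
    simp [ha, hb] at hab

theorem valuation_le_one_of_isIntegral {A K E : Type*} [CommRing A] [Field K] [Field E]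
    [Algebra A K] [Algebra K E] [Algebra A E] [IsScalarTower A K E]
    {v : Valuation K ℤᵐ⁰} (hA : v.Integers A) {w : Valuation E ℤᵐ⁰} {e : ℕ}
    (hw : ∀ x, w (algebraMap K E x) = v x ^ e) {b : E} (hb : IsIntegral A b) : w b ≤ 1 := by
  have h1 : ∀ a : A, w (algebraMap A E a) ≤ 1 := fun a ↦ by
    rw [IsScalarTower.algebraMap_apply A K E, hw]; exact pow_le_one' (hA.map_le_one a) _
  let φ : A →+* w.integer := (algebraMap A E).codRestrict w.integer h1
  have : IsIntegral w.integer b :=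
    hb.map_of_comp_eq φ (RingHom.id E) (RingHom.ext fun _ ↦ rfl)
  exact (Valuation.integer.integers w).mem_of_integral this

theorem LiesOverE.unique {K E : Type*} [Field K] [Field E] {w : Valuation E ℤᵐ⁰} {f : K →+* E}
    {v : Valuation K ℤᵐ⁰} (hv : Function.Surjective v) {e e' : ℕ} (h : LiesOverE w f v e)
    (h' : LiesOverE w f v e') : e = e' := by
  obtain ⟨x, hx⟩ := hv (WithZero.exp 1)
  have := (h.2 x).symm.trans (h'.2 x)
  rw [hx, ← WithZero.exp_nsmul, ← WithZero.exp_nsmul, WithZero.exp_inj] at this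
  simpa using this

set_option linter.deprecated false in
theorem exists_finset_valuations_of_integers {A K E : Type*} [CommRing A] [IsDomain A]
    [IsDiscreteValuationRing A] [IsAlgClosed (IsLocalRing.ResidueField A)] [Field K] [Field E]
    [Algebra A K] [IsFractionRing A K] [Algebra K E] [Algebra A E] [IsScalarTower A K E]
    [FiniteDimensional K E] [Algebra.IsSeparable K E]
    {v : Valuation K ℤᵐ⁰} (hv : Function.Surjective v) (hA : v.Integers A) :
    ∃ T : Finset (Valuation E ℤᵐ⁰),
      (∀ w ∈ T, Function.Surjective w ∧ LiesOver w (algebraMap K E) v) ∧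
      (∀ w, LiesOver w (algebraMap K E) v → ∃ w' ∈ T, ∃ r : ℕ, 0 < r ∧ ∀ x, w x = w' x ^ r) ∧
      (∀ e : Valuation E ℤᵐ⁰ → ℕ, (∀ w ∈ T, LiesOverE w (algebraMap K E) v (e w)) →
        ∑ w ∈ T, e w = Module.finrank K E) ∧
      (∀ w ∈ T, ∀ j N : ℕ, ∃ x, w x = WithZero.exp (-(j : ℤ)) ∧
        ∀ w' ∈ T, w' ≠ w → w' x ≤ WithZero.exp (-(N : ℤ))) := by
  classical
  let B := integralClosure A E
  have : IsDedekindDomain B := integralClosure.isDedekindDomain A K E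
  have : IsFractionRing B E := integralClosure.isFractionRing_of_finite_extension K E
  have : Module.Finite A B := IsIntegralClosure.finite A K E B
  have : Module.IsTorsionFree A B :=
    Module.isTorsionFree_iff_algebraMap_injective.2 <| Function.Injective.of_comp
      (f := algebraMap B E) <| by
        rw [← RingHom.coe_comp, ← IsScalarTower.algebraMap_eq, IsScalarTower.algebraMap_eq A K E,
          RingHom.coe_comp]
        exact (algebraMap K E).injective.comp (IsFractionRing.injective A K)
  set m := IsLocalRing.maximalIdeal A with hm
  have hm0 : m ≠ ⊥ := IsDiscreteValuationRing.not_a_field A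
  let pA : HeightOneSpectrum A := ⟨m, inferInstance, hm0⟩
  have hlt : ∀ a : A, v (algebraMap A K a) < 1 ↔ a ∈ m := fun a ↦ by
    rw [hm, IsLocalRing.mem_maximalIdeal, mem_nonunits_iff, hA.isUnit_iff_valuation_eq_one,
      lt_iff_le_and_ne]
    exact and_iff_right (hA.map_le_one a)
  have hvA : ∀ x, v x = pA.valuation K x := by
    obtain ⟨r, hr, h⟩ := exists_eq_pow_of_lt_one_iff_mem pA v hA.map_le_one hlt
    obtain rfl := eq_one_of_pow_surjective hr hv h
    simpa using h
  let I := {P // P ∈ IsDedekindDomain.primesOverFinset m B}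
  have hI : ∀ P : I, P.1.IsPrime ∧ P.1.LiesOver m := fun P ↦
    (IsDedekindDomain.mem_primesOverFinset_iff hm0 _).1 P.2
  let q : I → HeightOneSpectrum B := fun P ↦ ⟨P.1, (hI P).1, by
    have := (hI P).2
    exact Ideal.ne_bot_of_liesOver_of_ne_bot hm0 P.1⟩
  have hq : Function.Injective q := fun P Q h ↦ Subtype.ext (congrArg HeightOneSpectrum.asIdeal h)
  let val : I → Valuation E ℤᵐ⁰ := fun P ↦ (q P).valuation E
  have hval : Function.Injective val := fun P Q h ↦ hq <|
    HeightOneSpectrum.eq_of_valuation_isEquiv_valuation (K := E) (by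
      rw [show (q P).valuation E = (q Q).valuation E from h])
  have hram : ∀ P : I, LiesOverE (val P) (algebraMap K E) v (m.ramificationIdx' P.1) := fun P ↦ by
    have := (hI P).1
    have := (hI P).2
    refine ⟨Nat.pos_of_ne_zero (Ideal.IsDedekindDomain.ramificationIdx'_ne_zero_of_liesOver _ hm0),
      fun x ↦ ?_⟩
    have : (q P).asIdeal.LiesOver pA.asIdeal := this
    rw [hvA]
    exact (HeightOneSpectrum.valuation_liesOver E pA (q P) x).symm
  refine ⟨Finset.univ.image val, ?_, ?_, ?_, ?_⟩
  · simp only [Finset.mem_image, Finset.mem_univ, true_and, forall_exists_index,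
      forall_apply_eq_imp_iff]
    exact fun P ↦ ⟨(q P).valuation_surjective E, _, hram P⟩
  · rintro w ⟨e, he, hw⟩
    have h1 : ∀ b : B, w (algebraMap B E b) ≤ 1 := fun b ↦
      valuation_le_one_of_isIntegral hA hw b.2
    obtain ⟨P, hP, hPw⟩ := exists_ideal_of_valuation_le_one w h1
    have hPm : P.LiesOver m := ⟨by
      ext a
      rw [Ideal.under_def, Ideal.mem_comap, hPw, ← IsScalarTower.algebraMap_apply,
        IsScalarTower.algebraMap_apply A K E, hw, pow_lt_one_iff he.ne', hlt]⟩
    let P' : I := ⟨P, (IsDedekindDomain.mem_primesOverFinset_iff hm0 _).2 ⟨hP, hPm⟩⟩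
    exact ⟨val P', Finset.mem_image_of_mem _ (Finset.mem_univ _),
      exists_eq_pow_of_lt_one_iff_mem (q P') w h1 fun b ↦ (hPw b).symm⟩
  · intro e he
    rw [Finset.sum_image hval.injOn, ← Ideal.sum_ramification_inertia B K E hm0,
      ← Finset.sum_coe_sort _ fun P ↦ m.ramificationIdx' P * m.inertiaDeg' P]
    refine Finset.sum_congr rfl fun P _ ↦ ?_
    have := (hI P).1
    have := (hI P).2
    rw [inertiaDeg_eq_one_of_isAlgClosed, mul_one]
    exact (he _ (Finset.mem_image_of_mem _ (Finset.mem_univ P))).unique hv (hram P)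
  · simp only [Finset.mem_image, Finset.mem_univ, true_and, forall_exists_index,
      forall_apply_eq_imp_iff]
    intro P j N
    obtain ⟨π, hπ⟩ := (q P).intValuation_exists_uniformizer
    obtain ⟨y, hy⟩ := IsDedekindDomain.exists_forall_sub_mem_ideal (s := Finset.univ)
      (fun Q : I ↦ Q.1) (fun Q ↦ if Q = P then j + 1 else N) (fun Q _ ↦ (q Q).prime)
      (fun Q _ Q' _ h ↦ fun h' ↦ h (Subtype.ext h')) (fun Q ↦ if Q.1 = P then π ^ j else 0)
    refine ⟨algebraMap B E y, ?_, fun Q hQ ↦ ?_⟩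
    · have h := hy P (Finset.mem_univ _)
      simp only [if_true] at h
      have h' := ((q P).intValuation_le_pow_iff_mem _ _).2 h
      rw [show val P = (q P).valuation E from rfl, HeightOneSpectrum.valuation_of_algebraMap]
      have hπj : (q P).intValuation (π ^ j) = WithZero.exp (-(j : ℤ)) := by
        rw [map_pow, hπ, ← WithZero.exp_nsmul]; simp
      rw [← hπj]
      refine Valuation.map_eq_of_sub_lt _ (h'.trans_lt ?_)
      rw [hπj, WithZero.exp_lt_exp]; push_cast; linarith
    · have h := hy Q (Finset.mem_univ _)
      have hQP : Q ≠ P := fun h ↦ hQ (by rw [h])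
      simp only [hQP, if_false, sub_zero] at h
      rw [show val Q = (q Q).valuation E from rfl, HeightOneSpectrum.valuation_of_algebraMap]
      exact ((q Q).intValuation_le_pow_iff_mem _ _).2 h

theorem integers_valuationSubring {K : Type*} [Field K] (v : Valuation K ℤᵐ⁰) :
    v.Integers v.valuationSubring :=
  ⟨Subtype.val_injective, fun x ↦ x.2, fun x hx ↦ ⟨⟨x, hx⟩, rfl⟩⟩

theorem isAlgClosed_of_bijective {k F : Type*} [Field k] [IsAlgClosed k] [Field F] (g : k →+* F)
    (hg : Function.Bijective g) : IsAlgClosed F := by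
  refine IsAlgClosed.of_exists_root _ fun p _ hp ↦ ?_
  let e := RingEquiv.ofBijective g hg
  have hdeg : (p.map (e.symm : F →+* k)).degree ≠ 0 := by
    rw [Polynomial.degree_map]
    exact (Polynomial.degree_pos_of_irreducible hp).ne'
  obtain ⟨x, hx⟩ := IsAlgClosed.exists_root _ hdeg
  refine ⟨e x, ?_⟩
  rw [Polynomial.IsRoot.def, Polynomial.eval_map] at hx
  have h := Polynomial.hom_eval₂ p (e.symm : F →+* k) (e : k →+* F) x
  have hc : (e : k →+* F).comp (e.symm : F →+* k) = RingHom.id F := by ext; simp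
  rw [hx, map_zero, hc, Polynomial.eval₂_id] at h
  exact h.symm

theorem isDiscreteValuationRing_valuationSubring {K : Type*} [Field K] {v : Valuation K ℤᵐ⁰}
    (hv : Function.Surjective v) : IsDiscreteValuationRing v.valuationSubring := by
  obtain ⟨x, hx⟩ := hv (WithZero.exp 1)
  let u : (ℤᵐ⁰)ˣ := Units.mk0 (WithZero.exp 1) WithZero.exp_ne_zero
  have hu : u ∈ MonoidWithZeroHom.valueGroup (.ofClass v : K →*₀ ℤᵐ⁰) :=
    MonoidWithZeroHom.mem_valueGroup _ ⟨x, hx⟩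
  have : Nontrivial (MonoidWithZeroHom.valueGroup (.ofClass v : K →*₀ ℤᵐ⁰)) :=
    ⟨⟨⟨u, hu⟩, 1, fun h ↦ by
      have h : WithZero.exp (1 : ℤ) = 1 := Units.ext_iff.1 (Subtype.ext_iff.1 h)
      simp at h⟩⟩
  infer_instance

theorem isAlgClosed_residueField {k K : Type*} [Field k] [IsAlgClosed k] [Field K] [Algebra k K]
    {v : Valuation K ℤᵐ⁰} (hk : ∀ c : k, c ≠ 0 → v (algebraMap k K c) = 1)
    (hres : ∀ x, v x ≤ 1 → ∃ c : k, v (x - algebraMap k K c) < 1) :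
    IsAlgClosed (IsLocalRing.ResidueField v.valuationSubring) := by
  have hk1 : ∀ c : k, v (algebraMap k K c) ≤ 1 := fun c ↦ by
    rcases eq_or_ne c 0 with rfl | hc
    · simp
    · exact (hk c hc).le
  let f : k →+* v.valuationSubring := (algebraMap k K).codRestrict v.valuationSubring.toSubring hk1
  let g := (IsLocalRing.residue v.valuationSubring).comp f
  have hg : Function.Bijective g := by
    refine ⟨g.injective, fun y ↦ ?_⟩
    obtain ⟨x, rfl⟩ := IsLocalRing.residue_surjective y
    obtain ⟨c, hc⟩ := hres x x.2
    refine ⟨c, ?_⟩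
    rw [RingHom.comp_apply, eq_comm, ← sub_eq_zero, ← map_sub, IsLocalRing.residue_eq_zero_iff,
      IsLocalRing.mem_maximalIdeal, mem_nonunits_iff,
      (integers_valuationSubring v).isUnit_iff_valuation_eq_one]
    exact hc.ne
  exact isAlgClosed_of_bijective g hg

theorem exists_finset_valuations {k K E : Type*} [Field k] [IsAlgClosed k] [Field K] [Field E]
    [Algebra k K] [Algebra K E] [FiniteDimensional K E] [Algebra.IsSeparable K E]
    {v : Valuation K ℤᵐ⁰} (hv : IsPlace (k := k) v)
    (hres : ∀ x, v x ≤ 1 → ∃ c : k, v (x - algebraMap k K c) < 1) :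
    ∃ T : Finset (Valuation E ℤᵐ⁰),
      (∀ w ∈ T, Function.Surjective w ∧ LiesOver w (algebraMap K E) v) ∧
      (∀ w, LiesOver w (algebraMap K E) v → ∃ w' ∈ T, ∃ r : ℕ, 0 < r ∧ ∀ x, w x = w' x ^ r) ∧
      (∀ e : Valuation E ℤᵐ⁰ → ℕ, (∀ w ∈ T, LiesOverE w (algebraMap K E) v (e w)) →
        ∑ w ∈ T, e w = Module.finrank K E) ∧
      (∀ w ∈ T, ∀ j N : ℕ, ∃ x, w x = WithZero.exp (-(j : ℤ)) ∧
        ∀ w' ∈ T, w' ≠ w → w' x ≤ WithZero.exp (-(N : ℤ))) := by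
  have := isDiscreteValuationRing_valuationSubring hv.1
  have := isAlgClosed_residueField hv.2 hres
  exact exists_finset_valuations_of_integers (A := v.valuationSubring) hv.1
    (integers_valuationSubring v)

theorem isAlgebraic_adjoin_of_transcendental {k K : Type*} [Field k] [Field K] [Algebra k K]
    {x y : K} (hy : Transcendental k y)
    (hfin : FiniteDimensional (IntermediateField.adjoin k {y}) K) (hx : Transcendental k x) :
    Algebra.IsAlgebraic (IntermediateField.adjoin k {x}) K := by
  have hyi : AlgebraicIndependent k (fun _ : Unit ↦ y) :=
    (algebraicIndependent_singleton_iff ()).2 hy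
  have hxi : AlgebraicIndependent k (fun _ : Unit ↦ x) :=
    (algebraicIndependent_singleton_iff ()).2 hx
  have hyb : IsTranscendenceBasis k (fun _ : Unit ↦ y) := by
    rw [AlgebraicIndependent.isTranscendenceBasis_iff_isAlgebraic hyi, Set.range_const,
      ← IntermediateField.isAlgebraic_adjoin_iff_top]
    infer_instance
  have hxb := hxi.isTranscendenceBasis_of_lift_trdeg_le_of_finite
    hyb.lift_cardinalMk_eq_trdeg.ge
  have := hxb.isAlgebraic_field
  rwa [Set.range_const] at this

theorem IsFunctionFieldOver.exists_residue {k K : Type*} [Field k] [IsAlgClosed k] [Field K]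
    [Algebra k K] (hK : IsFunctionFieldOver k K) {v : Valuation K ℤᵐ⁰}
    (hv : IsPlace (k := k) v) (x : K) (hx : v x ≤ 1) :
    ∃ c : k, v (x - algebraMap k K c) < 1 := by
  by_contra! h
  have h0 : ∀ c : k, v (algebraMap k K c) ≤ 1 := fun c ↦ by
    rcases eq_or_ne c 0 with rfl | hc
    · simp
    · exact (hv.2 c hc).le
  have h1 : ∀ c : k, v (x - algebraMap k K c) = 1 := fun c ↦
    le_antisymm (v.map_sub_le hx (h0 c)) (h c)
  have h2 : ∀ r : Polynomial k, r ≠ 0 → v (Polynomial.aeval x r) = 1 := fun r hr ↦ by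
    rw [(IsAlgClosed.splits r).eq_prod_roots, map_mul, Polynomial.aeval_C, map_mul,
      hv.2 _ (Polynomial.leadingCoeff_ne_zero.2 hr), one_mul, map_multiset_prod,
      map_multiset_prod, Multiset.map_map, Multiset.map_map]
    exact Multiset.prod_eq_one fun a ha ↦ by
      obtain ⟨b, -, rfl⟩ := Multiset.mem_map.1 ha
      simpa using h1 b
  have htr : Transcendental k x := by
    rw [transcendental_iff]
    intro p hp
    by_contra hp0
    simpa [hp] using h2 p hp0
  have hO : ∀ z : IntermediateField.adjoin k {x}, v (algebraMap _ K z) ≤ 1 := by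
    rintro ⟨z, hz⟩
    obtain ⟨r, s, rfl⟩ := (IntermediateField.mem_adjoin_simple_iff k z).1 hz
    change v (Polynomial.aeval x r / Polynomial.aeval x s) ≤ 1
    rcases eq_or_ne r 0 with rfl | hr
    · simp
    rcases eq_or_ne s 0 with rfl | hs
    · simp
    simp [h2 r hr, h2 s hs]
  obtain ⟨⟨y, hy, hfin⟩, -⟩ := hK
  have := isAlgebraic_adjoin_of_transcendental hy hfin htr
  obtain ⟨z, hz⟩ := hv.1 (WithZero.exp 1)
  have hzi : IsIntegral (IntermediateField.adjoin k {x}) z :=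
    (Algebra.IsAlgebraic.isAlgebraic z).isIntegral
  let φ : IntermediateField.adjoin k {x} →+* v.integer :=
    (algebraMap _ K).codRestrict v.integer hO
  have hzi' : IsIntegral v.integer z :=
    hzi.map_of_comp_eq φ (RingHom.id K) (RingHom.ext fun _ ↦ rfl)
  have := (Valuation.integer.integers v).mem_of_integral hzi'
  rw [Valuation.mem_integer_iff, hz, ← WithZero.exp_zero, WithZero.exp_le_exp] at this
  omega

theorem lt_iff_le_mul_exp_neg_one {x y : ℤᵐ⁰} (hy : y ≠ 0) :
    x < y ↔ x ≤ y * WithZero.exp (-1 : ℤ) := by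
  have h : y = y * WithZero.exp (-1 : ℤ) * WithZero.exp 1 := by
    rw [mul_assoc, ← WithZero.exp_add]; simp
  conv_lhs => rw [h]
  exact WithZero.lt_mul_exp_iff_le (mul_ne_zero hy WithZero.exp_ne_zero)

theorem exists_forall_mul_exp_neg_le {ι : Type*} [Finite ι] (a : ι → ℤᵐ⁰) {γ : ℤᵐ⁰}
    (hγ : γ ≠ 0) : ∃ n : ℕ, ∀ q, a q * WithZero.exp (-(n : ℤ)) ≤ γ := by
  have single : ∀ q, ∃ n : ℕ, a q * WithZero.exp (-(n : ℤ)) ≤ γ := fun q ↦ by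
    rcases eq_or_ne (a q) 0 with h | h
    · exact ⟨0, by simp [h]⟩
    · refine ⟨(WithZero.log (a q) - WithZero.log γ).toNat, ?_⟩
      rw [← WithZero.exp_log h, ← WithZero.exp_log hγ, ← WithZero.exp_add, WithZero.exp_le_exp,
        WithZero.log_exp, WithZero.log_exp]
      have := Int.self_le_toNat (WithZero.log (a q) - WithZero.log γ)
      linarith
  choose n hn using single
  obtain ⟨N, hN⟩ := (Set.finite_range n).bddAbove
  refine ⟨N, fun q ↦ le_trans (mul_le_mul_right ?_ _) (hn q)⟩
  rw [WithZero.exp_le_exp]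
  have := hN ⟨q, rfl⟩
  omega

section Descent

variable {k K L : Type*} [Field k] [Field K] [Field L] [Algebra k K] [Algebra k L] [Algebra K L]
  [IsScalarTower k K L] {S : Valuation K ℤᵐ⁰} {P : Valuation L ℤᵐ⁰} {e : ℕ}

theorem exists_sub_mul_pow_lt (hS : Function.Surjective S)
    (hres : ∀ x, P x ≤ 1 → ∃ c : k, P (x - algebraMap k L c) < 1)
    (hPS : LiesOverE P (algebraMap K L) S e) {u : L} (hu : P u = WithZero.exp (-1 : ℤ))
    {l : L} (hl : l ≠ 0) :
    ∃ a : K, ∃ i < e, P (l - algebraMap K L a * u ^ i) < P l := by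
  obtain ⟨t, ht⟩ := hS (WithZero.exp (-1 : ℤ))
  obtain ⟨he, hPS⟩ := hPS
  have hPl : P l ≠ 0 := (P.ne_zero_iff).2 hl
  set n : ℤ := -WithZero.log (P l) with hn
  have he' : (0 : ℤ) < e := by exact_mod_cast he
  obtain ⟨i, hi⟩ := Int.eq_ofNat_of_zero_le (Int.emod_nonneg n he'.ne')
  have hie : i < e := by
    have := Int.emod_lt_of_pos n he'
    rw [hi] at this; exact_mod_cast this
  set s : L := algebraMap K L t ^ (n / e) * u ^ i with hs
  have hPs : P s = P l := by
    rw [hs, map_mul, map_zpow₀, hPS, ht, map_pow, hu, ← WithZero.exp_nsmul, ← WithZero.exp_nsmul,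
      ← WithZero.exp_zsmul, ← WithZero.exp_add]
    conv_rhs => rw [← WithZero.exp_log hPl]
    rw [WithZero.exp_inj]
    have := Int.mul_ediv_add_emod n e
    simp only [nsmul_eq_mul, smul_eq_mul]
    rw [hi] at this
    linear_combination -this - hn
  have hs0 : s ≠ 0 := by
    rw [← P.ne_zero_iff, hPs]; exact hPl
  obtain ⟨c, hc⟩ := hres (l / s) (by rw [map_div₀, hPs, div_self hPl])
  refine ⟨algebraMap k K c * t ^ (n / e), i, hie, ?_⟩
  have : l - algebraMap K L (algebraMap k K c * t ^ (n / e)) * u ^ i =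
      (l / s - algebraMap k L c) * s := by
    rw [sub_mul, div_mul_cancel₀ _ hs0, map_mul, map_zpow₀, ← IsScalarTower.algebraMap_apply, hs]
    ring
  rw [this, map_mul, hPs]
  exact mul_lt_of_lt_one_left (zero_lt_iff.2 hPl) hc

theorem exists_mem_sub_le (hS : Function.Surjective S)
    (hres : ∀ x, P x ≤ 1 → ∃ c : k, P (x - algebraMap k L c) < 1)
    (hPS : LiesOverE P (algebraMap K L) S e) {u : L} (hu : P u = WithZero.exp (-1 : ℤ))
    (U : AddSubgroup L) (l : L)
    (hU : ∀ a : K, ∀ i < e, P (algebraMap K L a * u ^ i) ≤ P l → algebraMap K L a * u ^ i ∈ U)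
    (n : ℕ) : ∃ y ∈ U, P (l - y) ≤ P l * WithZero.exp (-(n : ℤ)) := by
  induction n with
  | zero => exact ⟨0, U.zero_mem, by simp⟩
  | succ n ih =>
    obtain ⟨y, hy, hyl⟩ := ih
    rcases eq_or_ne (l - y) 0 with h | h
    · exact ⟨y, hy, by simp [h]⟩
    obtain ⟨a, i, hi, ha⟩ := exists_sub_mul_pow_lt hS hres hPS hu h
    have h1 : P (l - y) ≤ P l := hyl.trans (mul_le_of_le_one_right' (by
      rw [← WithZero.exp_zero, WithZero.exp_le_exp]; omega))
    have h2 : P (algebraMap K L a * u ^ i) = P (l - y) :=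
      P.map_eq_of_sub_lt ((P.map_sub_swap _ _).trans_lt ha)
    refine ⟨y + algebraMap K L a * u ^ i, U.add_mem hy (hU a i hi (h2.le.trans h1)), ?_⟩
    rw [← sub_sub]
    rw [lt_iff_le_mul_exp_neg_one (P.ne_zero_iff.2 h)] at ha
    refine ha.trans ?_
    rw [Nat.cast_succ, neg_add, WithZero.exp_add, ← mul_assoc]
    exact mul_le_mul_left hyl _

end Descent

theorem linearIndependent_of_valuation {ι M A : Type*} [Fintype ι] [Field M] [CommRing A]
    [Algebra M A] {R : Valuation M ℤᵐ⁰} {v : ι → Valuation A ℤᵐ⁰} {e : ι → ℕ}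
    (hv : ∀ q m, v q (algebraMap M A m) = R m ^ e q)
    (x : (Σ q, Fin (e q)) → A) (hx : ∀ p, v p.1 (x p) = WithZero.exp (-((p.2 : ℕ) : ℤ)))
    (hx' : ∀ p q, q ≠ p.1 → v q (x p) ≤ WithZero.exp (-(e q : ℤ))) :
    LinearIndependent M x := by
  classical
  rw [Fintype.linearIndependent_iff]
  intro c hc
  by_contra! hne
  obtain ⟨p', hp'⟩ := hne
  obtain ⟨p₁, -, hp₁⟩ := Finset.exists_max_image Finset.univ (fun p ↦ R (c p))
    ⟨p', Finset.mem_univ _⟩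
  have hR0 : R (c p₁) ≠ 0 := (zero_lt_iff.2 (R.ne_zero_iff.2 hp')).trans_le
    (hp₁ p' (Finset.mem_univ _)) |>.ne'
  obtain ⟨p₀, hp₀, hmin⟩ := Finset.exists_min_image
    (Finset.univ.filter fun p ↦ R (c p) = R (c p₁)) (fun p ↦ (p.2 : ℕ)) ⟨p₁, by simp⟩
  simp only [Finset.mem_filter, Finset.mem_univ, true_and] at hp₀ hmin
  set r := R (c p₁)
  have hval : ∀ q p, v q (c p • x p) = R (c p) ^ e q * v q (x p) := fun q p ↦ by
    rw [Algebra.smul_def, map_mul, hv]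
  have hr0 : r ^ e p₀.1 ≠ 0 := pow_ne_zero _ hR0
  have hlt : WithZero.exp (-(e p₀.1 : ℤ)) < WithZero.exp (-((p₀.2 : ℕ) : ℤ)) := by
    rw [WithZero.exp_lt_exp]; have := p₀.2.2; omega
  have h := (v p₀.1).map_sum_eq_of_lt (f := fun p ↦ c p • x p) (Finset.mem_univ p₀) (by
    intro p hp
    have hpp : p ≠ p₀ := by simpa using hp
    rw [hval, hval, hx, hp₀]
    by_cases hq : p₀.1 = p.1
    · obtain ⟨q, j⟩ := p
      obtain ⟨q₀, j₀⟩ := p₀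
      obtain rfl : q₀ = q := hq
      rw [hx ⟨q₀, j⟩]
      rcases (hp₁ ⟨q₀, j⟩ (Finset.mem_univ _)).lt_or_eq with h | h
      · rw [lt_iff_le_mul_exp_neg_one hR0] at h
        calc _ ≤ (r * WithZero.exp (-1 : ℤ)) ^ e q₀ * 1 := by
              gcongr
              rw [← WithZero.exp_zero, WithZero.exp_le_exp]; omega
          _ = r ^ e q₀ * WithZero.exp (-(e q₀ : ℤ)) := by
              rw [mul_one, mul_pow, ← WithZero.exp_nsmul]; simp
          _ < _ := by gcongr; exact zero_lt_iff.2 hr0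
      · have h1 := hmin _ h
        have h2 : j₀ ≠ j := fun h ↦ hpp (by rw [h])
        rw [h]
        refine mul_lt_mul_of_pos_left ?_ (zero_lt_iff.2 hr0)
        rw [WithZero.exp_lt_exp]
        have h3 : (j₀ : ℕ) ≠ j := fun h ↦ h2 (Fin.ext h)
        simp only at h1 ⊢
        omega
    · calc _ ≤ r ^ e p₀.1 * WithZero.exp (-(e p₀.1 : ℤ)) := by
            gcongr
            · exact hp₁ p (Finset.mem_univ _)
            · exact hx' p p₀.1 hq
        _ < _ := by gcongr; exact zero_lt_iff.2 hr0)
  rw [hc, map_zero, hval, hx, hp₀] at h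
  exact mul_ne_zero hr0 WithZero.exp_ne_zero h.symm

section Approximation

variable {k K L M A ι : Type*} [Field k] [Field K] [Field L] [Field M] [CommRing A] [Finite ι]
  [Algebra k K] [Algebra k L] [Algebra K L] [IsScalarTower k K L] [Algebra K M] [Algebra K A]
  [Algebra L A] [Algebra M A] [IsScalarTower K L A] [IsScalarTower K M A]
  {S : Valuation K ℤᵐ⁰} {P : Valuation L ℤᵐ⁰} {R : Valuation M ℤᵐ⁰} {v : ι → Valuation A ℤᵐ⁰}
  {eP : ℕ} {e f : ι → ℕ}

theorem exists_mem_approx_mul (hS : Function.Surjective S)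
    (hres : ∀ x, P x ≤ 1 → ∃ c : k, P (x - algebraMap k L c) < 1)
    (hPS : LiesOverE P (algebraMap K L) S eP) (hf : ∀ q, 0 < f q)
    (hvL : ∀ q l, v q (algebraMap L A l) = P l ^ f q)
    {u : L} (hu : P u = WithZero.exp (-1 : ℤ)) (U : Submodule M A) {γ η : ℤᵐ⁰} (hγ : γ ≠ 0)
    (hU : ∀ i < eP, ∀ m : M, ∃ y ∈ U, ∀ q,
      v q (algebraMap M A m * algebraMap L A (u ^ i) - y) ≤
        v q (algebraMap M A m * algebraMap L A (u ^ i)) * η)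
    (l : L) (m : M) (hη : ∀ q, v q (algebraMap L A l * algebraMap M A m) * η ≤ γ) :
    ∃ y ∈ U, ∀ q, v q (algebraMap L A l * algebraMap M A m - y) ≤ γ := by
  let V : AddSubgroup L :=
    { carrier := {y | ∃ z ∈ U, ∀ q, v q (algebraMap L A y * algebraMap M A m - z) ≤ γ}
      add_mem' := by
        rintro a b ⟨z, hz, ha⟩ ⟨z', hz', hb⟩
        refine ⟨z + z', U.add_mem hz hz', fun q ↦ ?_⟩
        rw [map_add, add_mul, add_sub_add_comm]
        exact (v q).map_add_le (ha q) (hb q)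
      zero_mem' := ⟨0, U.zero_mem, by simp⟩
      neg_mem' := by
        rintro a ⟨z, hz, ha⟩
        refine ⟨-z, U.neg_mem hz, fun q ↦ ?_⟩
        rw [map_neg, neg_mul, ← neg_sub', Valuation.map_neg]
        exact ha q }
  have hV : ∀ a : K, ∀ i < eP, P (algebraMap K L a * u ^ i) ≤ P l →
      algebraMap K L a * u ^ i ∈ V := by
    intro a i hi ha
    obtain ⟨y, hy, hyq⟩ := hU i hi (algebraMap K M a * m)
    have : algebraMap M A (algebraMap K M a * m) * algebraMap L A (u ^ i) =
        algebraMap L A (algebraMap K L a * u ^ i) * algebraMap M A m := by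
      rw [map_mul, map_mul, ← IsScalarTower.algebraMap_apply, ← IsScalarTower.algebraMap_apply]
      ring
    rw [this] at hyq
    refine ⟨y, hy, fun q ↦ (hyq q).trans (le_trans ?_ (hη q))⟩
    rw [map_mul, map_mul (v q) (algebraMap L A l), hvL, hvL]
    gcongr
  obtain ⟨n, hn⟩ := exists_forall_mul_exp_neg_le
    (fun q ↦ v q (algebraMap L A l * algebraMap M A m)) hγ
  obtain ⟨y, ⟨z, hz, hyz⟩, hy⟩ := exists_mem_sub_le hS hres hPS hu V l hV n
  refine ⟨z, hz, fun q ↦ ?_⟩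
  have : algebraMap L A l * algebraMap M A m - z =
      algebraMap L A (l - y) * algebraMap M A m + (algebraMap L A y * algebraMap M A m - z) := by
    rw [map_sub]; ring
  rw [this]
  refine (v q).map_add_le (le_trans ?_ (hn q)) (hyz q)
  rw [map_mul, map_mul, hvL, hvL, mul_right_comm]
  gcongr
  calc P (l - y) ^ f q ≤ (P l * WithZero.exp (-(n : ℤ))) ^ f q := by gcongr
    _ = P l ^ f q * WithZero.exp (-(n : ℤ)) ^ f q := mul_pow ..
    _ ≤ _ := by
      gcongr
      refine pow_le_of_le_one zero_le ?_ (hf q).ne'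
      rw [← WithZero.exp_zero, WithZero.exp_le_exp]; omega

theorem exists_forall_exists_mem_approx (hS : Function.Surjective S)
    (hres : ∀ x, P x ≤ 1 → ∃ c : k, P (x - algebraMap k L c) < 1)
    (hPS : LiesOverE P (algebraMap K L) S eP) (hf : ∀ q, 0 < f q)
    (hvL : ∀ q l, v q (algebraMap L A l) = P l ^ f q) {γ : ℤᵐ⁰} (hγ : γ ≠ 0) {x : A}
    (hx : x ∈ AddSubgroup.closure
      {z : A | ∃ (l : L) (m : M), z = algebraMap L A l * algebraMap M A m}) :
    ∃ η : ℤᵐ⁰, η ≠ 0 ∧ ∀ (u : L) (U : Submodule M A), P u = WithZero.exp (-1 : ℤ) →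
      (∀ i < eP, ∀ m : M, ∃ y ∈ U, ∀ q,
        v q (algebraMap M A m * algebraMap L A (u ^ i) - y) ≤
          v q (algebraMap M A m * algebraMap L A (u ^ i)) * η) →
      ∃ y ∈ U, ∀ q, v q (x - y) ≤ γ := by
  induction hx using AddSubgroup.closure_induction with
  | mem x hx =>
    obtain ⟨l, m, rfl⟩ := hx
    obtain ⟨n, hn⟩ := exists_forall_mul_exp_neg_le
      (fun q ↦ v q (algebraMap L A l * algebraMap M A m)) hγ
    exact ⟨_, WithZero.exp_ne_zero, fun u U hu hU ↦
      exists_mem_approx_mul hS hres hPS hf hvL hu U hγ hU l m hn⟩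
  | zero => exact ⟨1, one_ne_zero, fun u U _ _ ↦ ⟨0, U.zero_mem, by simp⟩⟩
  | add a b _ _ iha ihb =>
    obtain ⟨η, hη, ha⟩ := iha
    obtain ⟨η', hη', hb⟩ := ihb
    refine ⟨min η η', by rcases min_choice η η' with h | h <;> rwa [h], fun u U hu hU ↦ ?_⟩
    obtain ⟨y, hy, hya⟩ := ha u U hu fun i hi m ↦ (hU i hi m).imp fun y h ↦
      ⟨h.1, fun q ↦ (h.2 q).trans (mul_le_mul_right (min_le_left _ _) _)⟩
    obtain ⟨z, hz, hzb⟩ := hb u U hu fun i hi m ↦ (hU i hi m).imp fun y h ↦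
      ⟨h.1, fun q ↦ (h.2 q).trans (mul_le_mul_right (min_le_right _ _) _)⟩
    refine ⟨y + z, U.add_mem hy hz, fun q ↦ ?_⟩
    rw [add_sub_add_comm]
    exact (v q).map_add_le (hya q) (hzb q)
  | neg a _ iha =>
    obtain ⟨η, hη, ha⟩ := iha
    refine ⟨η, hη, fun u U hu hU ↦ ?_⟩
    obtain ⟨y, hy, hya⟩ := ha u U hu hU
    refine ⟨-y, U.neg_mem hy, fun q ↦ ?_⟩
    rw [← neg_sub', Valuation.map_neg]
    exact hya q

end Approximation

theorem sum_le_of_approx {k K L M A ι : Type*} [Field k] [Field K] [Field L] [Field M]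
    [CommRing A] [Fintype ι]
    [Algebra k K] [Algebra k L] [Algebra K L] [IsScalarTower k K L] [Algebra K M] [Algebra K A]
    [Algebra L A] [Algebra M A] [IsScalarTower K L A] [IsScalarTower K M A]
    {S : Valuation K ℤᵐ⁰} {P : Valuation L ℤᵐ⁰} {R : Valuation M ℤᵐ⁰}
    {v : ι → Valuation A ℤᵐ⁰} {eP : ℕ} {e f : ι → ℕ} (hS : Function.Surjective S)
    (hres : ∀ x, P x ≤ 1 → ∃ c : k, P (x - algebraMap k L c) < 1)
    (hPS : LiesOverE P (algebraMap K L) S eP) (hf : ∀ q, 0 < f q)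
    (hvL : ∀ q l, v q (algebraMap L A l) = P l ^ f q)
    (hvM : ∀ q m, v q (algebraMap M A m) = R m ^ e q)
    (hA : ∀ x : A, x ∈ AddSubgroup.closure
      {z : A | ∃ (l : L) (m : M), z = algebraMap L A l * algebraMap M A m})
    (happ : ∀ q, ∀ j N : ℕ, ∃ x, v q x = WithZero.exp (-(j : ℤ)) ∧
      ∀ q', q' ≠ q → v q' x ≤ WithZero.exp (-(N : ℤ)))
    {D : ℕ} (hD : ∀ η : ℤᵐ⁰, η ≠ 0 → ∃ (u : L) (b : Fin D → A), P u = WithZero.exp (-1 : ℤ) ∧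
      (∀ i < eP, ∀ m : M, ∃ y ∈ Submodule.span M (Set.range b), ∀ q,
        v q (algebraMap M A m * algebraMap L A (u ^ i) - y) ≤
          v q (algebraMap M A m * algebraMap L A (u ^ i)) * η)) :
    ∑ q, e q ≤ D := by
  classical
  set N := ∑ q, e q with hN
  have heN : ∀ q, e q ≤ N := fun q ↦ Finset.single_le_sum (fun _ _ ↦ Nat.zero_le _)
    (Finset.mem_univ q)
  choose x hx hx' using fun p : Σ q, Fin (e q) ↦ happ p.1 p.2 N
  choose η hη0 hη using fun p ↦ exists_forall_exists_mem_approx (γ := WithZero.exp (-(N : ℤ)))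
    hS hres hPS hf hvL WithZero.exp_ne_zero (hA (x p))
  obtain ⟨n, hn⟩ : ∃ n : ℕ, ∀ p, WithZero.exp (-(n : ℤ)) ≤ η p := by
    choose n hn using fun p ↦ exists_forall_mul_exp_neg_le (fun _ : Unit ↦ (1 : ℤᵐ⁰)) (hη0 p)
    obtain ⟨B, hB⟩ := (Set.finite_range n).bddAbove
    refine ⟨B, fun p ↦ le_trans ?_ (hn p ())⟩
    rw [one_mul, WithZero.exp_le_exp]
    have := hB ⟨p, rfl⟩
    omega
  obtain ⟨u, b, hu, hb⟩ := hD _ (WithZero.exp_ne_zero (a := -(n : ℤ)))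
  choose y hyU hy using fun p ↦ hη p u _ hu fun i hi m ↦ (hb i hi m).imp fun y h ↦
      ⟨h.1, fun q ↦ (h.2 q).trans (mul_le_mul_right (hn p) _)⟩
  have hlin : LinearIndependent M y := by
    refine linearIndependent_of_valuation hvM y (fun p ↦ ?_) fun p q hq ↦ ?_
    · rw [← hx p]
      refine Valuation.map_eq_of_sub_lt _ ?_
      rw [Valuation.map_sub_swap]
      refine (hy p p.1).trans_lt ?_
      rw [hx, WithZero.exp_lt_exp]
      have := heN p.1
      have := p.2.2
      omega
    · rw [← sub_sub_cancel (x p) (y p)]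
      refine ((v q).map_sub_le (hx' p q hq) (hy p q)).trans ?_
      rw [WithZero.exp_le_exp]
      have := heN q
      omega
  have hfin : FiniteDimensional M (Submodule.span M (Set.range b)) :=
    FiniteDimensional.span_of_finite M (Set.finite_range b)
  let y' : (Σ q, Fin (e q)) → Submodule.span M (Set.range b) := fun p ↦ ⟨y p, hyU p⟩
  have hlin' : LinearIndependent M y' :=
    LinearIndependent.of_comp (Submodule.subtype _) hlin
  calc N = Fintype.card (Σ q, Fin (e q)) := by simp [hN]
    _ ≤ Module.finrank M (Submodule.span M (Set.range b)) := hlin'.fintype_card_le_finrank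
    _ ≤ Fintype.card (Fin D) := finrank_range_le_card b
    _ = D := by simp

theorem exists_pow_sub_le_of_eq_one {k L : Type*} [Field k] [IsAlgClosed k] [Field L]
    [Algebra k L] {P : Valuation L ℤᵐ⁰} (hP : ∀ c : k, c ≠ 0 → P (algebraMap k L c) = 1)
    (hres : ∀ x, P x ≤ 1 → ∃ c : k, P (x - algebraMap k L c) < 1) {n : ℕ} (hn : (n : k) ≠ 0)
    {x : L} (hx : P x = 1) (N : ℕ) :
    ∃ y, P y = 1 ∧ P (y ^ n - x) ≤ WithZero.exp (-((N + 1 : ℕ) : ℤ)) := by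
  have hn0 : n ≠ 0 := by rintro rfl; simp at hn
  have hPn : P (n : L) = 1 := by simpa using hP n hn
  induction N with
  | zero =>
    obtain ⟨c, hc⟩ := hres x hx.le
    have hc0 : c ≠ 0 := by
      rintro rfl
      simp [hx] at hc
    obtain ⟨b, hb⟩ := IsAlgClosed.exists_pow_nat_eq c (Nat.pos_of_ne_zero hn0)
    have hb0 : b ≠ 0 := by
      rintro rfl
      exact hc0 (by rw [← hb, zero_pow hn0])
    refine ⟨algebraMap k L b, hP b hb0, ?_⟩
    rw [← map_pow, hb, Valuation.map_sub_swap]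
    simpa using (lt_iff_le_mul_exp_neg_one one_ne_zero).1 hc
  | succ N ih =>
    obtain ⟨y, hy, hyN⟩ := ih
    have hy0 : y ≠ 0 := by rw [← P.ne_zero_iff, hy]; exact one_ne_zero
    have hn0' : (n : L) ≠ 0 := by rw [← P.ne_zero_iff, hPn]; exact one_ne_zero
    set δ := (x - y ^ n) / (n * y ^ (n - 1)) with hδ
    have hPδ : P δ = P (y ^ n - x) := by
      rw [hδ, map_div₀, map_mul, hPn, map_pow, hy, P.map_sub_swap]; simp
    rw [← hPδ] at hyN
    have hδ1 : P δ < 1 := hyN.trans_lt (by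
      rw [← WithZero.exp_zero, WithZero.exp_lt_exp]; push_cast; omega)
    let y' : P.integer := ⟨y, hy.le⟩
    let δ' : P.integer := ⟨δ, hδ1.le⟩
    obtain ⟨z, hz⟩ := Polynomial.powAddExpansion y' δ' n
    have hz' : (y + δ) ^ n = y ^ n + n * y ^ (n - 1) * δ + z * δ ^ 2 := by
      have := congrArg (Subtype.val : P.integer → L) hz
      simpa using this
    refine ⟨y + δ, ?_, ?_⟩
    · rw [P.map_add_eq_of_lt_left (by rwa [hy]), hy]
    · have : (y + δ) ^ n - x = z * δ ^ 2 := by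
        rw [hz', hδ, mul_div_cancel₀ _ (mul_ne_zero hn0' (pow_ne_zero _ hy0))]
        ring
      rw [this, map_mul, map_pow]
      calc P z * P δ ^ 2 ≤ 1 * WithZero.exp (-((N + 1 : ℕ) : ℤ)) ^ 2 := by
            gcongr
            exact z.2
        _ ≤ _ := by
            rw [one_mul, ← WithZero.exp_nsmul, WithZero.exp_le_exp]
            push_cast
            simp only [nsmul_eq_mul]
            push_cast
            linarith

theorem exists_pow_sub_le {k L : Type*} [Field k] [IsAlgClosed k] [Field L]
    [Algebra k L] {P : Valuation L ℤᵐ⁰} (hP : IsPlace (k := k) P)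
    (hres : ∀ x, P x ≤ 1 → ∃ c : k, P (x - algebraMap k L c) < 1) {n : ℕ} (hn : (n : k) ≠ 0)
    {t : L} {j : ℤ} (ht : P t = WithZero.exp j ^ n) (N : ℕ) :
    ∃ y, P y = WithZero.exp j ∧ P (y ^ n - t) ≤ WithZero.exp (-(N : ℤ)) := by
  obtain ⟨s, hs⟩ := hP.1 (WithZero.exp j)
  have hs0 : s ≠ 0 := by rw [← P.ne_zero_iff, hs]; exact WithZero.exp_ne_zero
  obtain ⟨N', hN'⟩ := exists_forall_mul_exp_neg_le (fun _ : Unit ↦ P s ^ n)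
    (WithZero.exp_ne_zero (a := -(N : ℤ)))
  obtain ⟨y, hy, hyN⟩ := exists_pow_sub_le_of_eq_one hP.2 hres hn (x := t / s ^ n)
    (by rw [map_div₀, map_pow, hs, ht, div_self (pow_ne_zero _ WithZero.exp_ne_zero)]) N'
  refine ⟨s * y, by rw [map_mul, hy, hs, mul_one], ?_⟩
  have : (s * y) ^ n - t = s ^ n * (y ^ n - t / s ^ n) := by
    rw [mul_pow, mul_sub, mul_div_cancel₀ _ (pow_ne_zero _ hs0)]
  rw [this, map_mul, map_pow]
  refine le_trans (mul_le_mul_right (hyN.trans ?_) _) (hN' ())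
  rw [WithZero.exp_le_exp]
  push_cast
  omega

theorem exists_sub_mul_le_of_pow_sub_pow_le {k F : Type*} [Field k] [IsAlgClosed k] [Field F]
    [Algebra k F] {Q : Valuation F ℤᵐ⁰} {g : ℕ} (hg : (g : k) ≠ 0) {x y : F} {γ : ℤᵐ⁰}
    (hγ : γ ≠ 0) (h : Q (x ^ g - y ^ g) ≤ γ ^ g) :
    ∃ c : k, c ≠ 0 ∧ Q (x - algebraMap k F c * y) ≤ γ := by
  have hg0 : 0 < g := Nat.pos_of_ne_zero fun h ↦ hg (by simp [h])
  have : NeZero (g : k) := ⟨hg⟩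
  have : NeZero g := ⟨hg0.ne'⟩
  obtain ⟨ζ, hζ⟩ := HasEnoughRootsOfUnity.exists_primitiveRoot k g
  have hζF := hζ.map_of_injective (algebraMap k F).injective
  by_contra! hc
  rw [hζF.pow_sub_pow_eq_prod_sub_mul _ _ hg0, map_prod] at h
  refine absurd h (not_le.2 ?_)
  have hlt : ∀ z ∈ Polynomial.nthRootsFinset g (1 : F), γ < Q (x - z * y) := fun z hz ↦ by
    obtain ⟨i, -, rfl⟩ := hζF.eq_pow_of_pow_eq_one ((Polynomial.mem_nthRootsFinset hg0 1).1 hz)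
    rw [← map_pow]
    exact hc _ (pow_ne_zero _ (hζ.ne_zero hg0.ne'))
  have hprod := Finset.prod_lt_prod_of_nonempty (fun _ _ ↦ zero_lt_iff.2 hγ) hlt
    ⟨1, Polynomial.one_mem_nthRootsFinset hg0⟩
  rwa [Finset.prod_const, hζF.card_nthRootsFinset] at hprod

theorem valuation_pow_sub_pow_le {A : Type*} [CommRing A] (v : Valuation A ℤᵐ⁰) {x y : A}
    {γ η : ℤᵐ⁰} (hx : v x ≤ γ) (hy : v y ≤ γ) (hxy : v (x - y) ≤ γ * η) (n : ℕ) :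
    v (x ^ n - y ^ n) ≤ γ ^ n * η := by
  induction n with
  | zero => simp
  | succ n ih =>
    have : x ^ (n + 1) - y ^ (n + 1) = (x ^ n - y ^ n) * x + y ^ n * (x - y) := by ring
    rw [this]
    refine v.map_add_le ?_ ?_
    · rw [map_mul, pow_succ, mul_right_comm]
      gcongr
    · rw [map_mul, map_pow, pow_succ, mul_assoc]
      gcongr

theorem exp_neg_pow_le (N : ℕ) {e : ℕ} (he : 0 < e) :
    (WithZero.exp (-(N : ℤ)) : ℤᵐ⁰) ^ e ≤ WithZero.exp (-(N : ℤ)) :=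
  pow_le_of_le_one zero_le (by rw [← WithZero.exp_zero, WithZero.exp_le_exp]; omega) he.ne'

theorem ramification_mul_gcd_le {k K L M F : Type*} [Field k] [IsAlgClosed k] [Field K] [Field L]
    [Field M] [Field F] [Algebra k K] [Algebra k L] [Algebra k M] [Algebra k F]
    [Algebra K L] [IsScalarTower k K L]
    [Algebra K M] [IsScalarTower k K M] [Algebra K F] [IsScalarTower k K F] [Algebra L F]
    [Algebra M F] [IsScalarTower K L F] [IsScalarTower K M F]
    {S : Valuation K ℤᵐ⁰} {P : Valuation L ℤᵐ⁰} {R : Valuation M ℤᵐ⁰} {Q : Valuation F ℤᵐ⁰}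
    {eP eR e f : ℕ} (hS : Function.Surjective S)
    (hP : IsPlace (k := k) P) (hR : IsPlace (k := k) R) (hQ : Function.Surjective Q)
    (hPres : ∀ x, P x ≤ 1 → ∃ c : k, P (x - algebraMap k L c) < 1)
    (hRres : ∀ x, R x ≤ 1 → ∃ c : k, R (x - algebraMap k M c) < 1)
    (hPS : LiesOverE P (algebraMap K L) S eP) (hRS : LiesOverE R (algebraMap K M) S eR)
    (hQP : LiesOverE Q (algebraMap L F) P f) (hQR : LiesOverE Q (algebraMap M F) R e)
    (hF : ∀ x : F, x ∈ AddSubgroup.closure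
      {z : F | ∃ (l : L) (m : M), z = algebraMap L F l * algebraMap M F m})
    (htame : (eP : k) ≠ 0) : e * eP.gcd eR ≤ eP := by
  set g := eP.gcd eR with hg
  obtain ⟨d, hd⟩ : g ∣ eP := Nat.gcd_dvd_left ..
  obtain ⟨r, hr⟩ : g ∣ eR := Nat.gcd_dvd_right ..
  have hg0 : (g : k) ≠ 0 := fun h ↦ htame (by rw [hd, Nat.cast_mul, h, zero_mul])
  have hd0 : 0 < d := Nat.pos_of_mul_pos_left (hd ▸ hPS.1)
  suffices h : ∑ _ : Unit, e ≤ d by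
    rw [Finset.sum_const, Finset.card_univ, Fintype.card_unit, one_smul] at h
    calc e * g ≤ d * g := Nat.mul_le_mul_right _ h
      _ = eP := by rw [hd, mul_comm]
  obtain ⟨t, ht⟩ := hS (WithZero.exp (-1 : ℤ))
  refine sum_le_of_approx (v := fun _ : Unit ↦ Q) (f := fun _ ↦ f) hS hPres hPS (fun _ ↦ hQP.1)
    (fun _ ↦ hQP.2) (fun _ ↦ hQR.2) hF (fun _ j N ↦ ?_) fun η hη ↦ ?_
  · obtain ⟨x, hx⟩ := hQ (WithZero.exp (-(j : ℤ)))
    exact ⟨x, hx, fun q hq ↦ absurd rfl hq⟩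
  set c : ℤᵐ⁰ := (WithZero.exp (-1 : ℤ) ^ d) ^ f with hc
  have hη0 : c * min η 1 ≠ 0 := mul_ne_zero (pow_ne_zero _ (pow_ne_zero _ WithZero.exp_ne_zero))
    (by rcases min_choice η 1 with h | h <;> simp [h, hη])
  obtain ⟨N, hN⟩ := exists_forall_mul_exp_neg_le (fun _ : Unit ↦ 1) (pow_ne_zero g hη0)
  simp only [one_mul, forall_const] at hN
  obtain ⟨u, hu, huN⟩ := exists_pow_sub_le hP hPres htame (t := algebraMap K L t) (j := -1)
    (by rw [hPS.2, ht]) N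
  obtain ⟨B, hB, hBN⟩ := exists_pow_sub_le hR hRres hg0 (t := algebraMap K M t) (j := -(r : ℤ))
    (by
      rw [hRS.2, ht, hr, ← WithZero.exp_nsmul, ← WithZero.exp_nsmul, WithZero.exp_inj]
      simp [mul_comm]) N
  obtain ⟨b, -, hb⟩ := exists_sub_mul_le_of_pow_sub_pow_le (Q := Q) hg0 hη0
    (x := algebraMap L F (u ^ d)) (y := algebraMap M F B) (by
      have : algebraMap L F (u ^ d) ^ g - algebraMap M F B ^ g =
          algebraMap L F (u ^ eP - algebraMap K L t) -
            algebraMap M F (B ^ g - algebraMap K M t) := by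
        rw [map_sub, map_sub, ← IsScalarTower.algebraMap_apply, ← IsScalarTower.algebraMap_apply,
          hd]
        simp only [map_pow]
        ring
      rw [this]
      refine (Q.map_sub_le ?_ ?_).trans hN
      · rw [hQP.2]
        exact (pow_le_pow_left₀ zero_le huN _).trans (exp_neg_pow_le N hQP.1)
      · rw [hQR.2]
        exact (pow_le_pow_left₀ zero_le hBN _).trans (exp_neg_pow_le N hQR.1))
  set B' : M := algebraMap k M b * B with hB'
  have hBF : algebraMap M F B' = algebraMap k F b * algebraMap M F B := by
    rw [hB', map_mul, IsScalarTower.algebraMap_apply k K M, ← IsScalarTower.algebraMap_apply K M F,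
      ← IsScalarTower.algebraMap_apply k K F]
  rw [← hBF] at hb
  have hud : Q (algebraMap L F (u ^ d)) = c := by rw [hQP.2, map_pow, hu]
  have hBc : Q (algebraMap M F B') ≤ c := by
    rw [← sub_sub_cancel (algebraMap L F (u ^ d)) (algebraMap M F B')]
    exact Q.map_sub_le hud.le (hb.trans (mul_le_of_le_one_right' (min_le_right _ _)))
  refine ⟨u, fun j : Fin d ↦ algebraMap L F (u ^ (j : ℕ)), hu, fun i hi m ↦
    ⟨(m * B' ^ (i / d)) • algebraMap L F (u ^ (i % d)), Submodule.smul_mem _ _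
      (Submodule.subset_span ⟨⟨i % d, Nat.mod_lt _ hd0⟩, rfl⟩), fun _ ↦ ?_⟩⟩
  have hui : algebraMap L F (u ^ i) =
      algebraMap L F (u ^ d) ^ (i / d) * algebraMap L F (u ^ (i % d)) := by
    rw [← map_pow, ← map_mul, ← pow_mul, ← pow_add, Nat.div_add_mod]
  have : algebraMap M F m * algebraMap L F (u ^ i) -
      (m * B' ^ (i / d)) • algebraMap L F (u ^ (i % d)) =
      algebraMap M F m * algebraMap L F (u ^ (i % d)) *
        (algebraMap L F (u ^ d) ^ (i / d) - algebraMap M F B' ^ (i / d)) := by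
    rw [hui, Algebra.smul_def, map_mul, map_pow (algebraMap M F)]
    ring
  rw [this, map_mul]
  calc _ ≤ Q (algebraMap M F m * algebraMap L F (u ^ (i % d))) * (c ^ (i / d) * η) := by
        gcongr
        exact valuation_pow_sub_pow_le Q hud.le hBc
          (hb.trans (mul_le_mul_right (min_le_left _ _) _)) _
    _ = _ := by
        rw [hui, map_mul, map_mul, map_mul, map_pow Q, hud]
        ac_rfl

theorem eq_of_pow_eq_pow {L : Type*} [Field L] {P P' : Valuation L ℤᵐ⁰}
    (hP : Function.Surjective P) (hP' : Function.Surjective P') {a b : ℕ} (ha : 0 < a)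
    (h : ∀ x, P x ^ a = P' x ^ b) : P = P' := by
  have key : ∀ {V W : Valuation L ℤᵐ⁰} {m n : ℕ}, Function.Surjective V →
      (∀ x, V x ^ m = W x ^ n) → n ∣ m := by
    intro V W m n hV h
    obtain ⟨x, hx⟩ := hV (WithZero.exp 1)
    have hx0 : W x ≠ 0 := by
      rw [W.ne_zero_iff, ← V.ne_zero_iff, hx]; exact WithZero.exp_ne_zero
    have := h x
    rw [hx, ← WithZero.exp_log hx0, ← WithZero.exp_nsmul, ← WithZero.exp_nsmul,
      WithZero.exp_inj, nsmul_eq_mul, nsmul_eq_mul, mul_one] at this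
    exact Int.natCast_dvd_natCast.1 ⟨_, this⟩
  obtain rfl : a = b := Nat.dvd_antisymm (key hP' fun x ↦ (h x).symm) (key hP h)
  ext x
  exact (pow_left_inj₀ zero_le zero_le ha.ne').1 (h x)

theorem ramification_mul_eq {K L M F : Type*} [Field K] [Field L]
    [Field M] [Field F] [Algebra K L] [Algebra K M] [Algebra K F] [Algebra L F]
    [Algebra M F] [IsScalarTower K L F] [IsScalarTower K M F]
    {S : Valuation K ℤᵐ⁰} {P : Valuation L ℤᵐ⁰} {R : Valuation M ℤᵐ⁰} {Q : Valuation F ℤᵐ⁰}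
    {eP eR e f : ℕ} (hS : Function.Surjective S)
    (hPS : LiesOverE P (algebraMap K L) S eP) (hRS : LiesOverE R (algebraMap K M) S eR)
    (hQP : LiesOverE Q (algebraMap L F) P f) (hQR : LiesOverE Q (algebraMap M F) R e) :
    eP * f = eR * e := by
  refine LiesOverE.unique hS (w := Q) (f := algebraMap K F) ⟨Nat.mul_pos hPS.1 hQP.1, fun x ↦ ?_⟩
    ⟨Nat.mul_pos hRS.1 hQR.1, fun x ↦ ?_⟩
  · rw [IsScalarTower.algebraMap_apply K L F, hQP.2, hPS.2, pow_mul]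
  · rw [IsScalarTower.algebraMap_apply K M F, hQR.2, hRS.2, pow_mul]

theorem ramification_mul_gcd_eq {k K L M F : Type*} [Field k] [IsAlgClosed k] [Field K] [Field L]
    [Field M] [Field F] [Algebra k K] [Algebra k L] [Algebra k M] [Algebra k F]
    [Algebra K L] [IsScalarTower k K L]
    [Algebra K M] [IsScalarTower k K M] [Algebra K F] [IsScalarTower k K F] [Algebra L F]
    [Algebra M F] [IsScalarTower K L F] [IsScalarTower K M F]
    {S : Valuation K ℤᵐ⁰} {P : Valuation L ℤᵐ⁰} {R : Valuation M ℤᵐ⁰} {Q : Valuation F ℤᵐ⁰}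
    {eP eR e f : ℕ} (hS : Function.Surjective S)
    (hP : IsPlace (k := k) P) (hR : IsPlace (k := k) R) (hQ : Function.Surjective Q)
    (hPres : ∀ x, P x ≤ 1 → ∃ c : k, P (x - algebraMap k L c) < 1)
    (hRres : ∀ x, R x ≤ 1 → ∃ c : k, R (x - algebraMap k M c) < 1)
    (hPS : LiesOverE P (algebraMap K L) S eP) (hRS : LiesOverE R (algebraMap K M) S eR)
    (hQP : LiesOverE Q (algebraMap L F) P f) (hQR : LiesOverE Q (algebraMap M F) R e)
    (hF : ∀ x : F, x ∈ AddSubgroup.closure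
      {z : F | ∃ (l : L) (m : M), z = algebraMap L F l * algebraMap M F m})
    (htame : (eP : k) ≠ 0 ∨ (eR : k) ≠ 0) : e * eP.gcd eR = eP := by
  have hmul := ramification_mul_eq hS hPS hRS hQP hQR
  have hdvd : eP ∣ e * eP.gcd eR := by
    rw [← Nat.gcd_mul_left]
    exact Nat.dvd_gcd (dvd_mul_left ..) ⟨f, by rw [hmul, mul_comm]⟩
  have hdvd' : eR ∣ f * eR.gcd eP := by
    rw [← Nat.gcd_mul_left]
    exact Nat.dvd_gcd (dvd_mul_left ..) ⟨e, by rw [← hmul, mul_comm]⟩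
  rcases htame with h | h
  · exact le_antisymm
      (ramification_mul_gcd_le hS hP hR hQ hPres hRres hPS hRS hQP hQR hF h)
      (Nat.le_of_dvd (Nat.mul_pos hQR.1 (Nat.gcd_pos_of_pos_left _ hPS.1)) hdvd)
  · have hF' : ∀ x : F, x ∈ AddSubgroup.closure
        {z : F | ∃ (m : M) (l : L), z = algebraMap M F m * algebraMap L F l} := fun x ↦ by
      refine AddSubgroup.closure_mono ?_ (hF x)
      rintro z ⟨l, m, rfl⟩
      exact ⟨m, l, mul_comm _ _⟩
    have heq : f * eR.gcd eP = eR := le_antisymm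
      (ramification_mul_gcd_le hS hR hP hQ hRres hPres hRS hPS hQR hQP hF' h)
      (Nat.le_of_dvd (Nat.mul_pos hQP.1 (Nat.gcd_pos_of_pos_left _ hRS.1)) hdvd')
    refine Nat.eq_of_mul_eq_mul_left hQP.1 ?_
    rw [mul_comm f eP, hmul, Nat.gcd_comm]
    linear_combination e * heq

theorem sum_ramification_le {k K L M I : Type*} [Field k] [Field K] [Field L] [Field M]
    [Finite I] {F : I → Type*} [∀ i, Field (F i)]
    [Algebra k K] [Algebra k L] [Algebra K L] [IsScalarTower k K L] [Algebra K M]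
    [∀ i, Algebra K (F i)] [∀ i, Algebra L (F i)] [∀ i, Algebra M (F i)]
    [∀ i, IsScalarTower K L (F i)] [∀ i, IsScalarTower K M (F i)]
    {S : Valuation K ℤᵐ⁰} {P : Valuation L ℤᵐ⁰} {R : Valuation M ℤᵐ⁰} {eP : ℕ}
    (hS : Function.Surjective S) (hP : Function.Surjective P)
    (hres : ∀ x, P x ≤ 1 → ∃ c : k, P (x - algebraMap k L c) < 1)
    (hPS : LiesOverE P (algebraMap K L) S eP)
    (hF : ∀ x : (i : I) → F i, x ∈ AddSubgroup.closure {z : (i : I) → F i |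
      ∃ (l : L) (m : M), z = algebraMap L _ l * algebraMap M _ m})
    (T : Finset (Σ i, Valuation (F i) ℤᵐ⁰)) (e : (Σ i, Valuation (F i) ℤᵐ⁰) → ℕ)
    (hTP : ∀ q ∈ T, LiesOver q.2 (algebraMap L (F q.1)) P)
    (hTR : ∀ q ∈ T, LiesOverE q.2 (algebraMap M (F q.1)) R (e q))
    (happ : ∀ i w, ⟨i, w⟩ ∈ T → ∀ j N : ℕ, ∃ x, w x = WithZero.exp (-(j : ℤ)) ∧
      ∀ w', ⟨i, w'⟩ ∈ T → w' ≠ w → w' x ≤ WithZero.exp (-(N : ℤ))) :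
    ∑ q ∈ T, e q ≤ eP := by
  classical
  rw [← Finset.sum_coe_sort]
  choose f hf using fun q : T ↦ hTP q q.2
  refine sum_le_of_approx (A := (i : I) → F i) (P := P) (R := R) (f := f)
    (v := fun q : T ↦ q.1.2.comap (Pi.evalRingHom F q.1.1)) hS hres hPS (fun q ↦ (hf q).1)
    (fun q ↦ (hf q).2) (fun q ↦ (hTR q q.2).2) hF ?_ ?_
  · rintro ⟨⟨i, w⟩, hw⟩ j N
    obtain ⟨x, hx, hx'⟩ := happ i w hw j N
    refine ⟨Pi.single i x, by simpa using hx, ?_⟩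
    rintro ⟨⟨i', w'⟩, hw'⟩ hne
    rcases eq_or_ne i' i with rfl | hi
    · simpa using hx' w' hw' fun h ↦ hne (by rw [Subtype.mk.injEq, h])
    · simp [Pi.single_eq_of_ne hi]
  · intro η hη
    obtain ⟨u, hu⟩ := hP (WithZero.exp (-1 : ℤ))
    refine ⟨u, fun j : Fin eP ↦ algebraMap L _ (u ^ (j : ℕ)), hu, fun i hi m ↦
      ⟨m • algebraMap L _ (u ^ i), Submodule.smul_mem _ _
        (Submodule.subset_span ⟨⟨i, hi⟩, rfl⟩), fun q ↦ ?_⟩⟩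
    rw [Algebra.smul_def, sub_self, map_zero]
    exact zero_le

end

/-- **Corollary (number of places over two given places).**
Let `L/K` and `M/K` be finite separable extensions of function fields of curves over an
algebraically closed field `k`, and let `L ⊗[K] M ≃ F₁ × ⋯ × Fₙ` be the decomposition into
fields.  Let `S`, `P`, `R` be places of `K`, `L`, `M` with `P`, `R` lying over `S`, at
least one of `P`, `R` tamely ramified over `S`, and for each `i` let `𝒫ᵢ` be the (finite)
set of places of `Fᵢ` lying over both `P` and `R`.  Then the total number of such places is
`∑ᵢ |𝒫ᵢ| = gcd(e(P/S), e(R/S))`. -/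
theorem count_places_gcd
    {k K L M : Type*} [Field k] [IsAlgClosed k] [Field K] [Field L] [Field M]
    [Algebra k K] [Algebra k L] [Algebra k M]
    [Algebra K L] [Algebra K M] [IsScalarTower k K L] [IsScalarTower k K M]
    (hK : IsFunctionFieldOver k K) (hL : IsFunctionFieldOver k L)
    (hM : IsFunctionFieldOver k M)
    [FiniteDimensional K L] [FiniteDimensional K M]
    -- the decomposition of `L ⊗[K] M` as a finite product of fields `Fᵢ`
    {n : ℕ} (F : Fin n → Type*) [∀ i, Field (F i)]
    [∀ i, Algebra k (F i)] [∀ i, Algebra K (F i)] [∀ i, Algebra L (F i)]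
    [∀ i, Algebra M (F i)] [∀ i, IsScalarTower k K (F i)]
    [∀ i, IsScalarTower K L (F i)] [∀ i, IsScalarTower K M (F i)]
    (e : (L ⊗[K] M) ≃ₐ[K] ((i : Fin n) → F i))
    (he : ∀ (i : Fin n) (l : L) (m : M),
      e (l ⊗ₜ[K] m) i = algebraMap L (F i) l * algebraMap M (F i) m)
    -- the places `S`, `P`, `R`, with `P` and `R` lying over `S`
    (S : Valuation K (WithZero (Multiplicative ℤ)))
    (P : Valuation L (WithZero (Multiplicative ℤ)))
    (R : Valuation M (WithZero (Multiplicative ℤ)))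
    (hS : IsPlace (k := k) S) (hP : IsPlace (k := k) P) (hR : IsPlace (k := k) R)
    (hPS : LiesOver P (algebraMap K L) S) (hRS : LiesOver R (algebraMap K M) S)
    [Algebra.IsSeparable K L] [Algebra.IsSeparable K M]
    -- `Pl i` is the set `𝒫ᵢ` of places of `Fᵢ` lying over both `P` and `R`
    (Pl : (i : Fin n) → Finset (Valuation (F i) (WithZero (Multiplicative ℤ))))
    (hPl : ∀ (i : Fin n) (Q : Valuation (F i) (WithZero (Multiplicative ℤ))),
      Q ∈ Pl i ↔ (IsPlace (k := k) Q ∧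
        LiesOver Q (algebraMap L (F i)) P ∧ LiesOver Q (algebraMap M (F i)) R)) :
    ∀ eP eR : ℕ, LiesOverE P (algebraMap K L) S eP → LiesOverE R (algebraMap K M) S eR →
      -- at least one of `P`, `R` is tamely ramified over `S`
      (¬ (ringChar k ∣ eP) ∨ ¬ (ringChar k ∣ eR)) →
      ∑ i : Fin n, (Pl i).card = Nat.gcd eP eR := by
  classical
  intro eP eR heP heR htame
  replace htame : (eP : k) ≠ 0 ∨ (eR : k) ≠ 0 := by
    simpa only [ne_eq, ringChar.spec] using htame
  have hSres := hK.exists_residue hS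
  have hPres := hL.exists_residue hP
  have hRres := hM.exists_residue hR
  have hspan : ∀ x : (i : Fin n) → F i, x ∈ AddSubgroup.closure {z : (i : Fin n) → F i |
      ∃ (l : L) (m : M), z = algebraMap L _ l * algebraMap M _ m} := fun x ↦ by
    obtain ⟨z, rfl⟩ := e.surjective x
    induction z with
    | zero => rw [map_zero]; exact zero_mem _
    | tmul l m => exact AddSubgroup.subset_closure ⟨l, m, funext fun i ↦ he i l m⟩
    | add a b ha hb => rw [map_add]; exact add_mem ha hb
  have hspan' : ∀ i, ∀ x : F i, x ∈ AddSubgroup.closure {z : F i |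
      ∃ (l : L) (m : M), z = algebraMap L _ l * algebraMap M _ m} := fun i x ↦ by
    have h := AddSubgroup.mem_map_of_mem (Pi.evalRingHom F i).toAddMonoidHom
      (hspan (Pi.single i x))
    rw [AddMonoidHom.map_closure] at h
    have hx : (Pi.evalRingHom F i).toAddMonoidHom (Pi.single i x) = x := Pi.single_eq_same i x
    rw [hx] at h
    refine AddSubgroup.closure_mono ?_ h
    rintro _ ⟨_, ⟨l, m, rfl⟩, rfl⟩
    exact ⟨l, m, rfl⟩
  have hfinK : ∀ i, FiniteDimensional K (F i) := fun i ↦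
    Module.Finite.of_surjective ((LinearMap.proj i).comp e.toLinearMap) <|
      (Function.surjective_eval i).comp e.surjective
  have hfinM : ∀ i, FiniteDimensional M (F i) := fun i ↦
    Module.Finite.of_restrictScalars_finite K M (F i)
  have hsep : ∀ i, Algebra.IsSeparable M (F i) := fun i ↦ ⟨fun x ↦ by
    rw [← mem_separableClosure_iff]
    refine (AddSubgroup.closure_le (separableClosure M (F i)).toSubfield.toAddSubgroup).2 ?_
      (hspan' i x)
    rintro _ ⟨l, m, rfl⟩
    refine mul_mem (S := IntermediateField M (F i)) (mem_separableClosure_iff.2 ?_)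
      (algebraMap_mem _ m)
    exact IsSeparable.tower_top M (IsSeparable.map (IsScalarTower.toAlgHom K L (F i))
      (algebraMap L (F i)).injective (Algebra.IsSeparable.isSeparable K l))⟩
  obtain ⟨TL, hTL, hTL', hTLsum, -⟩ := exists_finset_valuations (E := L) hS hSres
  choose T hT hT' hTsum hTapp using fun i ↦ exists_finset_valuations (E := F i) hR hRres
  have hPTL : P ∈ TL := by
    obtain ⟨P', hP', r, hr, h⟩ := hTL' P hPS
    obtain rfl := eq_one_of_pow_surjective hr hP.1 h
    rwa [show P = P' from Valuation.ext fun x ↦ by simpa using h x]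
  let 𝒬 : Finset (Σ i, Valuation (F i) (WithZero (Multiplicative ℤ))) := Finset.univ.sigma T
  have hQmem : ∀ q : Σ i, Valuation (F i) (WithZero (Multiplicative ℤ)), q ∈ 𝒬 ↔ q.2 ∈ T q.1 :=
    fun q ↦ by simp [𝒬]
  choose! eQ heQ using fun (q : Σ i, Valuation (F i) (WithZero (Multiplicative ℤ))) (hq : q ∈ 𝒬) ↦
    (hT q.1 q.2 ((hQmem q).1 hq)).2
  choose! eL heL using fun (w : Valuation L (WithZero (Multiplicative ℤ))) (hw : w ∈ TL) ↦
    (hTL w hw).2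
  have hrestrict : ∀ q ∈ 𝒬, ∃ P' ∈ TL, LiesOver q.2 (algebraMap L (F q.1)) P' := fun q hq ↦ by
    have h : LiesOver (q.2.comap (algebraMap L (F q.1))) (algebraMap K L) S := by
      refine ⟨eR * eQ q, Nat.mul_pos heR.1 (heQ q hq).1, fun x ↦ ?_⟩
      rw [Valuation.comap_apply, ← IsScalarTower.algebraMap_apply,
        IsScalarTower.algebraMap_apply K M, (heQ q hq).2, heR.2, pow_mul]
    obtain ⟨P', hP', r, hr, h⟩ := hTL' _ h
    exact ⟨P', hP', r, hr, h⟩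
  have : Nonempty (Valuation L (WithZero (Multiplicative ℤ))) := ⟨P⟩
  choose! π hπ hπ' using hrestrict
  have hlocal : ∀ P' ∈ TL, ∑ q ∈ 𝒬 with π q = P', eQ q ≤ eL P' := fun P' hP' ↦ by
    have hP'place : IsPlace (k := k) P' := ⟨(hTL P' hP').1, fun c hc ↦ by
      rw [IsScalarTower.algebraMap_apply k K L, (heL P' hP').2, hS.2 c hc, one_pow]⟩
    refine sum_ramification_le (K := K) (R := R) hS.1 hP'place.1
      (hL.exists_residue hP'place) (heL P' hP') hspan _ eQ (fun q hq ↦ ?_) (fun q hq ↦ ?_) ?_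
    · obtain ⟨hq𝒬, rfl⟩ := Finset.mem_filter.1 hq
      exact hπ' q hq𝒬
    · exact heQ q (Finset.mem_filter.1 hq).1
    · intro i w hw j N
      obtain ⟨x, hx, hx'⟩ := hTapp i w ((hQmem _).1 (Finset.mem_filter.1 hw).1) j N
      exact ⟨x, hx, fun w' hw' ↦ hx' w' ((hQmem _).1 (Finset.mem_filter.1 hw').1)⟩
  have hrank : ∑ i, Module.finrank M (F i) = Module.finrank K L := by
    have h := e.toLinearEquiv.finrank_eq
    rw [Module.finrank_tensorProduct, Module.finrank_pi_fintype] at h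
    simp_rw [← Module.finrank_mul_finrank K M (F _)] at h
    rw [← Finset.mul_sum, mul_comm] at h
    exact (Nat.eq_of_mul_eq_mul_left Module.finrank_pos h).symm
  have hsum : ∑ P' ∈ TL, ∑ q ∈ 𝒬 with π q = P', eQ q = ∑ P' ∈ TL, eL P' := by
    rw [Finset.sum_fiberwise_of_maps_to hπ, hTLsum eL heL, ← hrank, Finset.sum_sigma]
    exact Finset.sum_congr rfl fun i _ ↦ hTsum i (fun w ↦ eQ ⟨i, w⟩) fun w hw ↦
      heQ ⟨i, w⟩ ((hQmem _).2 hw)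
  have hPsum : ∑ q ∈ 𝒬 with π q = P, eQ q = eP :=
    ((Finset.sum_eq_sum_iff_of_le hlocal).1 hsum P hPTL).trans ((heL P hPTL).unique hS.1 heP)
  have heq : ∀ q ∈ 𝒬.filter (π · = P), eQ q * eP.gcd eR = eP := fun q hq ↦ by
    obtain ⟨hq, hqP⟩ := Finset.mem_filter.1 hq
    obtain ⟨f, hf⟩ := hπ' q hq
    rw [hqP] at hf
    exact ramification_mul_gcd_eq hS.1 hP hR (hT _ _ ((hQmem q).1 hq)).1 hPres hRres heP heR hf
      (heQ q hq) (hspan' q.1) htame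
  have hcard : (𝒬.filter (π · = P)).card = eP.gcd eR := by
    have h : ∑ q ∈ 𝒬 with π q = P, eQ q * eP.gcd eR = ∑ q ∈ 𝒬 with π q = P, eP :=
      Finset.sum_congr rfl heq
    rw [← Finset.sum_mul, hPsum, Finset.sum_const, smul_eq_mul, mul_comm _ eP] at h
    exact Nat.eq_of_mul_eq_mul_left heP.1 h.symm
  rw [← hcard, ← Finset.card_sigma]
  congr 1
  ext q
  rw [Finset.mem_sigma, Finset.mem_filter, hQmem, hPl]
  constructor
  · rintro ⟨-, hQ, ⟨a, ha, hQP⟩, hQR⟩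
    obtain ⟨w, hw, r, hr, h⟩ := hT' q.1 q.2 hQR
    obtain rfl := eq_one_of_pow_surjective hr hQ.1 h
    have hqT : q.2 ∈ T q.1 := by
      rwa [show q.2 = w from Valuation.ext fun x ↦ by simpa using h x]
    refine ⟨hqT, ?_⟩
    have hq := (hQmem q).2 hqT
    obtain ⟨b, hb, hQP'⟩ := hπ' q hq
    exact eq_of_pow_eq_pow (hTL _ (hπ q hq)).1 hP.1 hb fun x ↦ by rw [← hQP', ← hQP]
  · rintro ⟨hqT, hq⟩
    have hq' := hπ' q ((hQmem q).2 hqT)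
    rw [hq] at hq'
    refine ⟨Finset.mem_univ _, ⟨(hT _ _ hqT).1, fun c hc ↦ ?_⟩, hq', (hT _ _ hqT).2⟩
    obtain ⟨f, hf⟩ := hq'
    rw [IsScalarTower.algebraMap_apply k K (F q.1), IsScalarTower.algebraMap_apply K L (F q.1),
      ← IsScalarTower.algebraMap_apply k K L, hf.2, hP.2 c hc, one_pow]
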